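/- arXiv:2308.10246 — 2 statements merged into one kernel-verified Lean document; each statement's English description precedes it below -/
import Mathlib

section
/- Let p be a prime, let a, b, c, d ∈ 𝔽_p, let ∇ = a∂/∂X + b∂/∂Y, and let θ = X^p·Y − X·Y^p ∈ 𝔽_p[X,Y]. Then for all natural numbers l, k: if k = l then (∇^l(θ^k))(c,d) = l!·((∇θ)(c,d))^l, and if k ≠ l then (∇^l(θ^k))(c,d) = 0. -/
open MvPolynomial

/-- The differential operator `∇ = a ∂/∂X + b ∂/∂Y` on `𝔽_p[X,Y]`. -/
noncomputable def nabla {p : ℕ} (a b : ZMod p) :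
    Module.End (ZMod p) (MvPolynomial (Fin 2) (ZMod p)) :=
  a • (pderiv (0 : Fin 2)).toLinearMap + b • (pderiv (1 : Fin 2)).toLinearMap

/-- The Dickson polynomial `θ = X^p·Y − X·Y^p`. -/
noncomputable def theta (p : ℕ) : MvPolynomial (Fin 2) (ZMod p) :=
  X 0 ^ p * X 1 - X 0 * X 1 ^ p

/-- If `D` is a derivation killing `D f`, then the iterates of `D` on powers of `f` behave like
iterated derivatives of monomials. -/
theorem Derivation.pow_apply_pow_of_apply_apply_eq_zero {R A : Type*} [CommRing R] [CommRing A]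
    [Algebra R A] (D : Derivation R A A) {f : A} (hf : D (D f) = 0) (l k : ℕ) :
    ((D : A →ₗ[R] A) ^ l : Module.End R A) (f ^ k) =
      (k.descFactorial l : A) * f ^ (k - l) * D f ^ l := by
  induction l with
  | zero => simp
  | succ l ih =>
    rw [pow_succ', Module.End.mul_apply, ih]
    simp only [Derivation.coeFn_coe, Derivation.leibniz, Derivation.leibniz_pow, hf,
      Derivation.map_natCast, smul_eq_mul, nsmul_eq_mul, mul_zero, zero_add, add_zero,
      Nat.descFactorial_succ, Nat.cast_mul, Nat.sub_sub]
    ring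

/-- The operator `nabla a b` as a derivation. -/
noncomputable def nablaDerivation {p : ℕ} (a b : ZMod p) :
    Derivation (ZMod p) (MvPolynomial (Fin 2) (ZMod p)) (MvPolynomial (Fin 2) (ZMod p)) :=
  a • pderiv 0 + b • pderiv 1

theorem nablaDerivation_toLinearMap {p : ℕ} (a b : ZMod p) :
    (nablaDerivation a b).toLinearMap = nabla a b := rfl

theorem nabla_theta {p : ℕ} (a b : ZMod p) :
    nabla a b (theta p) = C b * X 0 ^ p - C a * X 1 ^ p := by
  simp [nabla, theta, Derivation.leibniz, Derivation.leibniz_pow, pderiv_X, smul_eq_C_mul]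
  ring

theorem nabla_nabla_theta {p : ℕ} (a b : ZMod p) :
    nabla a b (nabla a b (theta p)) = 0 := by
  rw [nabla_theta]
  simp [nabla, Derivation.leibniz, Derivation.leibniz_pow]

theorem eval_theta {p : ℕ} [Fact p.Prime] (v : Fin 2 → ZMod p) : eval v (theta p) = 0 := by
  simp [theta, ZMod.pow_card]

/-- `(∇^l(θ^k))(c,d) = l!·((∇θ)(c,d))^l` if `k = l`, and `0` otherwise. -/
theorem nabla_pow_theta_pow_eval (p : ℕ) [Fact p.Prime] (a b c d : ZMod p) (l k : ℕ) :
    eval ![c, d] ((nabla a b ^ l) (theta p ^ k)) =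
      if k = l then
        (Nat.factorial l : ZMod p) * (eval ![c, d] (nabla a b (theta p))) ^ l
      else 0 := by
  rw [← nablaDerivation_toLinearMap,
    Derivation.pow_apply_pow_of_apply_apply_eq_zero _ (nabla_nabla_theta a b)]
  simp only [map_mul, map_pow, map_natCast, eval_theta]
  split_ifs with h
  · subst h
    simp [Nat.descFactorial_self]
  · rcases lt_or_gt_of_ne h with h | h
    · simp [Nat.descFactorial_of_lt h]
    · simp [zero_pow (Nat.sub_ne_zero_of_lt h)]
end

section
/- Let p be a prime, f ≥ 1, q = p^f. In 𝔽_q[X_0,Y_0,…,X_{f−1},Y_{f−1}] let θ_0 = X_0·Y_{f−1}^p − Y_0·X_{f−1}^p and θ_k = X_k·Y_{k−1}^p − Y_k·X_{k−1}^p for 1 ≤ k ≤ f−1. For 0 ≤ j ≤ f−1 let c_j, d_j, g_j, h_j be natural numbers with c_j + d_j = r_j = g_j + h_j and r_j ≥ p^{f−j}. Let P = ∏_{j=0}^{f−1} X_j^{c_j}Y_j^{d_j} − ∏_{j=0}^{f−1} X_j^{g_j}Y_j^{h_j}, and suppose Σ_{j=0}^{f−1} d_j p^j = Σ_{j=0}^{f−1}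 h_j p^j + t(q−1) for some integer t ≥ 1. Assume neither monomial of P is a pure power of the X-variables alone or of the Y-variables alone (i.e., not all d_j = 0, not all c_j = 0, not all h_j = 0, not all g_j = 0). Then there exist natural numbers c_j', d_j' with c_j' + d_j' = r_j for all j and Σ_{j=0}^{f−1} d_j' p^j = Σ_{j=0}^{f−1} h_j p^j, such that P ≡ ∏_{j=0}^{f−1} X_j^{c_j'}Y_j^{d_j'} − ∏_{j=0}^{f−1} X_j^{g_j}Y_j^{h_j} modulo the ideal of 𝔽_q[X_0,Y_0,…,X_{f−1},Y_{f−1}] generated by θ_0, θ_1, …, θ_{f−1}. -/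
open MvPolynomial

/-- The twisted Dickson polynomial `θ_k = X_k·Y_{k−1}^p − Y_k·X_{k−1}^p`
(indices mod `f`, so `θ_0 = X_0·Y_{f−1}^p − Y_0·X_{f−1}^p`), in
`𝔽_q[X_0,Y_0,…,X_{f−1},Y_{f−1}]` with `X_j = X (j,0)`, `Y_j = X (j,1)`. -/
noncomputable def thetaTw (p f : ℕ) [Fact p.Prime] [NeZero f] (k : Fin f) :
    MvPolynomial (Fin f × Fin 2) (GaloisField p f) :=
  X (k, 0) * X (k - 1, 1) ^ p - X (k, 1) * X (k - 1, 0) ^ p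

/-- The monomial `∏ X_j^{c_j} Y_j^{d_j}`. -/
noncomputable def pairMonomial (R : Type*) [CommSemiring R] {f : ℕ} (c d : Fin f → ℕ) :
    MvPolynomial (Fin f × Fin 2) R :=
  ∏ j : Fin f, X (j, 0) ^ c j * X (j, 1) ^ d j

/-- The weight `∑ d_j p^j`. -/
def digitWeight (p : ℕ) {f : ℕ} (d : Fin f → ℕ) : ℕ :=
  ∑ j : Fin f, d j * p ^ (j : ℕ)

section PairMonomial

variable {R : Type*} [CommSemiring R] {f : ℕ}

theorem pairMonomial_add (c d c' d' : Fin f → ℕ) :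
    pairMonomial R (c + c') (d + d') = pairMonomial R c d * pairMonomial R c' d' := by
  simp only [pairMonomial, ← Finset.prod_mul_distrib, Pi.add_apply, pow_add]
  exact Finset.prod_congr rfl fun _ _ => by ring

theorem pairMonomial_single (k l : Fin f) (a b : ℕ) :
    pairMonomial R (Pi.single k a) (Pi.single l b) = X (k, 0) ^ a * X (l, 1) ^ b := by
  rw [pairMonomial, Finset.prod_mul_distrib, Finset.prod_eq_single k, Finset.prod_eq_single l] <;>
    simp +contextual

end PairMonomial

section DigitWeight

variable (p : ℕ) {f : ℕ}

theorem digitWeight_add (d d' : Fin f → ℕ) :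
    digitWeight p (d + d') = digitWeight p d + digitWeight p d' := by
  simp [digitWeight, add_mul, Finset.sum_add_distrib]

theorem digitWeight_single (k : Fin f) (a : ℕ) :
    digitWeight p (Pi.single k a) = a * p ^ (k : ℕ) := by
  simp [digitWeight, Pi.single_apply]

variable {p}

theorem digitWeight_pos (hp : 0 < p) {d : Fin f → ℕ} (hd : ¬ ∀ j, d j = 0) :
    0 < digitWeight p d := by
  push Not at hd
  obtain ⟨j, hj⟩ := hd
  exact Finset.sum_pos' (fun _ _ => Nat.zero_le _) ⟨j, Finset.mem_univ j, by positivity⟩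

theorem digitWeight_lt_pow : ∀ {f : ℕ} {d : Fin f → ℕ}, (∀ j, d j < p) → digitWeight p d < p ^ f
  | 0, _, _ => by simp [digitWeight]
  | f + 1, d, hd => by
    have ih := digitWeight_lt_pow (d := fun j : Fin f => d j.castSucc) fun j => hd _
    have hl := Nat.mul_le_mul_right (p ^ f) (Nat.succ_le_of_lt (hd (Fin.last f)))
    simp only [digitWeight] at ih ⊢
    rw [Fin.sum_univ_castSucc, pow_succ']
    simp only [Fin.val_castSucc, Fin.val_last]
    rw [Nat.succ_mul] at hl
    omega

end DigitWeight

theorem exists_eq_add_single {ι : Type*} [DecidableEq ι] {d : ι → ℕ} {k : ι} {a : ℕ}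
    (h : a ≤ d k) : ∃ d₀ : ι → ℕ, d = d₀ + Pi.single k a := by
  refine ⟨d - Pi.single k a, (tsub_add_cancel_of_le fun j => ?_).symm⟩
  by_cases hj : j = k
  · subst hj; simpa using h
  · simp [hj]

section ThetaTw

variable {p f : ℕ} [NeZero f]

theorem Fin.val_sub_one_add_one {k : Fin f} (hk : k ≠ 0) : ((k - 1 : Fin f) : ℕ) + 1 = k := by
  have hpos : (k : ℕ) ≠ 0 := fun h => hk (Fin.ext (by simpa using h))
  rw [Fin.val_sub_one_of_ne_zero hk]
  omega

theorem Fin.val_zero_sub_one_add_one : ((0 - 1 : Fin f) : ℕ) + 1 = f := by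
  obtain ⟨n, rfl⟩ := Nat.exists_eq_succ_of_ne_zero (NeZero.ne f)
  simp

/-- If no trade modulo `θ_k` with `k ≠ 0` is possible, then one modulo `θ_0` is. -/
theorem trade_zero_possible {d r : Fin f → ℕ} (hdr : d ≤ r) (hr : ∀ j, p ≤ r j)
    (hlow : p ^ f ≤ digitWeight p d) (hlt : digitWeight p d < digitWeight p r)
    (hstuck : ∀ k, k ≠ 0 → p ≤ d (k - 1) → d k = r k) :
    p ≤ d (0 - 1) ∧ d 0 < r 0 := by
  constructor
  · by_contra! hlast
    refine hlow.not_gt (digitWeight_lt_pow ?_)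
    have key : ∀ m : ℕ, ∀ j : Fin f, (j : ℕ) + m + 1 = f → d j < p := by
      intro m
      induction m with
      | zero =>
        intro j hj
        have := Fin.val_zero_sub_one_add_one (f := f)
        rwa [show j = 0 - 1 from Fin.ext (by omega)]
      | succ m ih =>
        intro j hj
        let k : Fin f := ⟨j + 1, by omega⟩
        have hk : k ≠ 0 := fun h => by simpa [k] using congrArg Fin.val h
        have hkj : k - 1 = j := Fin.ext (by
          have := Fin.val_sub_one_add_one hk
          simp [k] at this ⊢
          omega)
        by_contra! hp
        have h1 := hstuck k hk (by rwa [hkj])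
        have h2 := ih k (by simp only [k]; omega)
        exact (hr k).not_gt (h1 ▸ h2)
    exact fun j => key (f - 1 - j) j (by omega)
  · refine lt_of_le_of_ne (hdr 0) fun h0 => hlt.ne ?_
    have key : ∀ m : ℕ, ∀ j : Fin f, (j : ℕ) = m → d j = r j := by
      intro m
      induction m with
      | zero =>
        intro j hj
        rwa [show j = 0 from Fin.ext (by simpa using hj)]
      | succ m ih =>
        intro j hj
        have hj0 : j ≠ 0 := by rintro rfl; simp at hj
        have := Fin.val_sub_one_add_one hj0
        exact hstuck j hj0 (by rw [ih (j - 1) (by omega)]; exact hr _)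
    rw [show d = r from funext fun j => key j j rfl]

variable [Fact p.Prime]

/-- Trading `X_k Y_{k-1}^p` for `Y_k X_{k-1}^p` in a monomial, modulo `θ_k`. -/
theorem pairMonomial_sub_mem_span (c d : Fin f → ℕ) (k : Fin f) :
    pairMonomial (GaloisField p f) (c + Pi.single k 1) (d + Pi.single (k - 1) p) -
      pairMonomial (GaloisField p f) (c + Pi.single (k - 1) p) (d + Pi.single k 1) ∈
        Ideal.span (Set.range (thetaTw p f)) := by
  have h : pairMonomial (GaloisField p f) (c + Pi.single k 1) (d + Pi.single (k - 1) p) -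
      pairMonomial (GaloisField p f) (c + Pi.single (k - 1) p) (d + Pi.single k 1) =
      pairMonomial (GaloisField p f) c d * thetaTw p f k := by
    simp only [pairMonomial_add, pairMonomial_single, thetaTw]
    ring
  rw [h]
  exact Ideal.mul_mem_left _ _ (Ideal.subset_span ⟨k, rfl⟩)

/-- A monomial of weight at least `q` which is not a pure power of the `Y`-variables is congruent
to one whose weight is smaller by `q - 1`. -/
theorem exists_digitWeight_drop {r : Fin f → ℕ} (hr : ∀ j, p ≤ r j) (c d : Fin f → ℕ)
    (hcd : c + d = r) (hlow : p ^ f ≤ digitWeight p d)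
    (hlt : digitWeight p d < digitWeight p r) :
    ∃ c' d' : Fin f → ℕ, c' + d' = r ∧ digitWeight p d' + p ^ f = digitWeight p d + 1 ∧
      pairMonomial (GaloisField p f) c d - pairMonomial (GaloisField p f) c' d' ∈
        Ideal.span (Set.range (thetaTw p f)) := by
  have hp : 1 < p := (Fact.out : p.Prime).one_lt
  induction hN : ∑ j, d j using Nat.strong_induction_on generalizing c d with
  | _ N ih =>
  have trade : ∀ k, p ≤ d (k - 1) → d k < r k → ∃ c₀ d₀ : Fin f → ℕ,
      c = c₀ + Pi.single k 1 ∧ d = d₀ + Pi.single (k - 1) p := fun k h1 h2 => by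
    obtain ⟨c₀, hc₀⟩ := exists_eq_add_single (d := c) (k := k) (a := 1)
      (by have := congrFun hcd k; simp only [Pi.add_apply] at this; omega)
    obtain ⟨d₀, hd₀⟩ := exists_eq_add_single h1
    exact ⟨c₀, d₀, hc₀, hd₀⟩
  by_cases hstuck : ∀ k, k ≠ 0 → p ≤ d (k - 1) → d k = r k
  · have hdr : d ≤ r := hcd ▸ le_add_self
    obtain ⟨h1, h2⟩ := trade_zero_possible hdr hr hlow hlt hstuck
    obtain ⟨c₀, d₀, rfl, rfl⟩ := trade 0 h1 h2
    refine ⟨_, _, ?_, ?_, pairMonomial_sub_mem_span c₀ d₀ 0⟩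
    · rw [← hcd]
      abel
    simp only [digitWeight_add, digitWeight_single]
    rw [← pow_succ', Fin.val_zero_sub_one_add_one]
    simp
    ring
  · push Not at hstuck
    obtain ⟨k, hk, h1, h2⟩ := hstuck
    have hdr : d ≤ r := hcd ▸ le_add_self
    obtain ⟨c₀, d₀, rfl, rfl⟩ := trade k h1 (lt_of_le_of_ne (hdr k) h2)
    have hw : digitWeight p (d₀ + Pi.single k 1) = digitWeight p (d₀ + Pi.single (k - 1) p) := by
      simp only [digitWeight_add, digitWeight_single]
      rw [← pow_succ', Fin.val_sub_one_add_one hk, one_mul]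
    obtain ⟨c', d', hr', hw', hmem⟩ := ih (∑ j, (d₀ + Pi.single k 1 : Fin f → ℕ) j)
      (by rw [← hN]; simpa [Finset.sum_add_distrib] using hp)
      (c₀ + Pi.single (k - 1) p) (d₀ + Pi.single k 1) (by rw [← hcd]; abel)
      (hw ▸ hlow) (hw ▸ hlt) rfl
    exact ⟨c', d', hr', hw ▸ hw', by
      rw [← sub_add_sub_cancel]
      exact Ideal.add_mem _ (pairMonomial_sub_mem_span c₀ d₀ k) hmem⟩

theorem exists_digitWeight_eq {r : Fin f → ℕ} (hr : ∀ j, p ≤ r j) {w : ℕ} (hw : 0 < w) (t : ℕ)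
    (c d : Fin f → ℕ) (hcd : c + d = r) (hd : digitWeight p d = w + t * (p ^ f - 1))
    (hlt : digitWeight p d < digitWeight p r) :
    ∃ c' d' : Fin f → ℕ, c' + d' = r ∧ digitWeight p d' = w ∧
      pairMonomial (GaloisField p f) c d - pairMonomial (GaloisField p f) c' d' ∈
        Ideal.span (Set.range (thetaTw p f)) := by
  induction t generalizing c d with
  | zero => exact ⟨c, d, hcd, by simpa using hd, by simp⟩
  | succ t ih =>
    have hq : 0 < p ^ f := pow_pos (Fact.out : p.Prime).pos f
    rw [Nat.succ_mul] at hd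
    obtain ⟨c₁, d₁, hr₁, hw₁, hmem₁⟩ := exists_digitWeight_drop hr c d hcd (by omega) hlt
    obtain ⟨c', d', hr', hw', hmem'⟩ := ih c₁ d₁ hr₁ (by omega) (by omega)
    exact ⟨c', d', hr', hw', by
      rw [← sub_add_sub_cancel]
      exact Ideal.add_mem _ hmem₁ hmem'⟩

end ThetaTw

/-- monomial differences whose `Y`-weights differ by a positive multiple of
`q−1` can be rewritten, modulo the ideal `⟨θ_0,…,θ_{f−1}⟩`, as monomial differences with
equal `Y`-weights. -/
theorem monomial_difference_reduction (p f : ℕ) [Fact p.Prime] [NeZero f]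
    (c d g h r : Fin f → ℕ)
    (hcd : ∀ j, c j + d j = r j) (hgh : ∀ j, g j + h j = r j)
    (hr : ∀ j : Fin f, p ^ (f - (j : ℕ)) ≤ r j)
    (t : ℕ) (ht : 1 ≤ t)
    (hsum : ∑ j : Fin f, d j * p ^ (j : ℕ) =
      (∑ j : Fin f, h j * p ^ (j : ℕ)) + t * (p ^ f - 1))
    (hd : ¬ ∀ j, d j = 0) (hc : ¬ ∀ j, c j = 0)
    (hh : ¬ ∀ j, h j = 0) (hg : ¬ ∀ j, g j = 0) :
    ∃ c' d' : Fin f → ℕ,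
      (∀ j, c' j + d' j = r j) ∧
      (∑ j : Fin f, d' j * p ^ (j : ℕ) = ∑ j : Fin f, h j * p ^ (j : ℕ)) ∧
      ((∏ j : Fin f, X (j, 0) ^ c j * X (j, 1) ^ d j :
            MvPolynomial (Fin f × Fin 2) (GaloisField p f)) -
          ∏ j : Fin f, X (j, 0) ^ g j * X (j, 1) ^ h j) -
        ((∏ j : Fin f, X (j, 0) ^ c' j * X (j, 1) ^ d' j) -
          ∏ j : Fin f, X (j, 0) ^ g j * X (j, 1) ^ h j) ∈
        Ideal.span (Set.range (thetaTw p f)) := by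
  have hp : 0 < p := (Fact.out : p.Prime).pos
  have hcd' : c + d = r := funext hcd
  have hlt : digitWeight p d < digitWeight p r := by
    rw [← hcd', digitWeight_add]
    exact Nat.lt_add_of_pos_left (digitWeight_pos hp hc)
  have hpr : ∀ j, p ≤ r j := fun j =>
    (Nat.le_self_pow (by have := j.isLt; omega) p).trans (hr j)
  obtain ⟨c', d', hr', hw', hmem⟩ :=
    exists_digitWeight_eq hpr (digitWeight_pos hp hh) t c d hcd' hsum hlt
  refine ⟨c', d', congrFun hr', hw', ?_⟩
  rw [sub_sub_sub_cancel_right]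
  exact hmem
end
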